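/- Let G be a finite simple graph with a vertex cover S of size k, and let E₁ ⊆ E(G). Let A be a set of vertices of V(G) \ S that all have the same open neighborhood S₁ ⊆ S and for which the set S₂ = {x ∈ S₁ : ux ∈ E₁} is the same for every u ∈ A (so base(u) = |S₂| for every u ∈ A). Let w' : E(G) → {0,1} be a proper weight function with w'(e) = 1 for every e ∈ E₁ and color_{w'}(v) − base(v) ≤ 8k² + 8k for every vertex v of G, where base(v) is the number of edges of E₁ incident to v. Then at most k(8k² + 8k) + 1 vertices of A have color_{w'} different from |S₂|. -/

import Mathlib

variable {V : Type*}

/-- The color of a vertex `v` induced by a `{0,1}`-edge-weighting `w`: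
the sum of the weights of the edges of `G` incident to `v`. -/
noncomputable def vcColor [Finite V] (G : SimpleGraph V) (w : Sym2 V → Fin 2) (v : V) : ℕ :=
  ∑ e ∈ (G.incidenceSet v).toFinite.toFinset, (w e : ℕ)

/-- A weight function is proper if adjacent vertices get distinct colors. -/
def vcProper [Finite V] (G : SimpleGraph V) (w : Sym2 V → Fin 2) : Prop :=
  ∀ u v : V, G.Adj u v → vcColor G w u ≠ vcColor G w v

/-- `S` is a vertex cover of `G`. -/
def IsVertexCover (G : SimpleGraph V) (S : Set V) : Prop :=
  ∀ ⦃u v : V⦄, G.Adj u v → u ∈ S ∨ v ∈ S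

/-- `baseColor E₁ v` is the number of edges of `E₁` incident to `v`. -/
noncomputable def baseColor (E₁ : Set (Sym2 V)) (v : V) : ℕ := {e ∈ E₁ | v ∈ e}.ncard

/-- The edges incident to `v` of weight `1` that are not pre-weighted. -/
def extraEdges (G : SimpleGraph V) (E₁ : Set (Sym2 V)) (w : Sym2 V → Fin 2) (v : V) :
    Set (Sym2 V) :=
  {e ∈ G.incidenceSet v | w e = 1} \ {e ∈ E₁ | v ∈ e}

theorem vcColor_eq_ncard [Finite V] (G : SimpleGraph V) (w : Sym2 V → Fin 2) (v : V) :
    vcColor G w v = {e ∈ G.incidenceSet v | w e = 1}.ncard := by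
  classical
  have hval : ∀ i : Fin 2, (i : ℕ) = if i = 1 then 1 else 0 := by decide
  rw [vcColor, Finset.sum_congr rfl fun e _ => hval (w e), ← Finset.card_filter,
    ← Set.ncard_coe_finset]
  congr 1
  ext e
  simp

theorem ncard_extraEdges [Finite V] {G : SimpleGraph V} {E₁ : Set (Sym2 V)}
    {w : Sym2 V → Fin 2} (hE₁ : E₁ ⊆ G.edgeSet) (hext : ∀ e ∈ E₁, w e = 1) (v : V) :
    (extraEdges G E₁ w v).ncard = vcColor G w v - baseColor E₁ v := by
  rw [vcColor_eq_ncard, baseColor, extraEdges, Set.ncard_sdiff _ (Set.toFinite _)]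
  exact fun e he => ⟨⟨hE₁ he.1, he.2⟩, hext e he.1⟩

theorem extraEdges_nonempty [Finite V] {G : SimpleGraph V} {E₁ : Set (Sym2 V)}
    {w : Sym2 V → Fin 2} (hE₁ : E₁ ⊆ G.edgeSet) (hext : ∀ e ∈ E₁, w e = 1) {v : V}
    (hv : vcColor G w v ≠ baseColor E₁ v) : (extraEdges G E₁ w v).Nonempty := by
  rw [Set.nonempty_iff_ne_empty]
  intro h
  apply hv
  rw [vcColor_eq_ncard, baseColor]
  congr 1
  exact (Set.sdiff_eq_empty.mp h).antisymm fun e he => ⟨⟨hE₁ he.1, he.2⟩, hext e he.1⟩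

theorem baseColor_eq_ncard {G : SimpleGraph V} {E₁ : Set (Sym2 V)} (hE₁ : E₁ ⊆ G.edgeSet)
    (u : V) : baseColor E₁ u = {x ∈ G.neighborSet u | s(u, x) ∈ E₁}.ncard := by
  rw [baseColor, ← Set.ncard_image_of_injective _ (fun x y h => Sym2.congr_right.mp h :
    Function.Injective fun x => s(u, x))]
  congr 1
  ext e
  constructor
  · rintro ⟨he, x, rfl⟩
    exact ⟨x, ⟨hE₁ he, he⟩, rfl⟩
  · rintro ⟨x, hx, rfl⟩
    exact ⟨hx.2, Sym2.mem_mk_left u x⟩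

theorem ncard_setOf_mem_extraEdges_le [Finite V] (G : SimpleGraph V) (E₁ : Set (Sym2 V))
    (w : Sym2 V → Fin 2) (x : V) :
    {u | s(u, x) ∈ extraEdges G E₁ w x}.ncard ≤ (extraEdges G E₁ w x).ncard :=
  Set.ncard_le_ncard_of_injOn (fun u => s(u, x)) (fun _ hu => hu)
    (fun _ _ _ _ h => Sym2.congr_left.mp h) (Set.toFinite _)

/-- Let `A` be a class of vertices outside the vertex cover `S` that
share the same open neighborhood `S₁ ⊆ S` and the same set `S₂` of `E₁`-pre-weighted
neighbors.  If `w'` is a proper weighting extending the all-ones pre-weighting on `E₁`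
whose colors exceed the base colors by at most `8k² + 8k`, then at most
`k(8k² + 8k) + 1` vertices of `A` have color different from `|S₂|`. -/
theorem stmt_12 [Finite V] (G : SimpleGraph V) (k : ℕ) (S : Set V)
    (hvc : IsVertexCover G S) (hS : S.ncard = k)
    (E₁ : Set (Sym2 V)) (hE₁ : E₁ ⊆ G.edgeSet)
    (A : Set V) (hAS : ∀ u ∈ A, u ∉ S)
    (S₁ : Set V) (hS₁ : S₁ ⊆ S) (hnb : ∀ u ∈ A, G.neighborSet u = S₁)
    (S₂ : Set V) (hS₂ : ∀ u ∈ A, {x ∈ S₁ | s(u, x) ∈ E₁} = S₂)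
    (w' : Sym2 V → Fin 2) (hp : vcProper G w') (hext : ∀ e ∈ E₁, w' e = 1)
    (hbd : ∀ v : V, vcColor G w' v - baseColor E₁ v ≤ 8 * k ^ 2 + 8 * k) :
    {u ∈ A | vcColor G w' u ≠ S₂.ncard}.ncard ≤ k * (8 * k ^ 2 + 8 * k) + 1 := by
  have hsub : {u ∈ A | vcColor G w' u ≠ S₂.ncard} ⊆
      ⋃ x ∈ S, {u | s(u, x) ∈ extraEdges G E₁ w' x} := by
    rintro u ⟨hu, hcol⟩
    rw [← hS₂ u hu, ← hnb u hu, ← baseColor_eq_ncard hE₁] at hcol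
    obtain ⟨e, ⟨⟨he, x, rfl⟩, hw⟩, hne⟩ := extraEdges_nonempty hE₁ hext hcol
    have hx : x ∈ S := hS₁ (hnb u hu ▸ he)
    exact Set.mem_biUnion hx ⟨⟨⟨he, Sym2.mem_mk_right u x⟩, hw⟩,
      fun h => hne ⟨h.1, Sym2.mem_mk_left u x⟩⟩
  have hunion : (⋃ x ∈ S, {u | s(u, x) ∈ extraEdges G E₁ w' x}).ncard ≤
      k * (8 * k ^ 2 + 8 * k) := by
    classical
    have hfin := S.toFinite
    calc (⋃ x ∈ S, {u | s(u, x) ∈ extraEdges G E₁ w' x}).ncard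
        = (hfin.toFinset.biUnion fun x =>
            (Set.toFinite {u | s(u, x) ∈ extraEdges G E₁ w' x}).toFinset).card := by
          rw [← Set.ncard_coe_finset]
          congr 1
          ext u
          simp
      _ ≤ hfin.toFinset.card * (8 * k ^ 2 + 8 * k) := by
          refine Finset.card_biUnion_le_card_mul _ _ _ fun x _ => ?_
          rw [← Set.ncard_eq_toFinset_card]
          exact (ncard_setOf_mem_extraEdges_le G E₁ w' x).trans
            ((ncard_extraEdges hE₁ hext x).trans_le (hbd x))
      _ = k * (8 * k ^ 2 + 8 * k) := by rw [← Set.ncard_eq_toFinset_card, hS]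
  exact ((Set.ncard_le_ncard hsub (Set.toFinite _)).trans hunion).trans (Nat.le_succ _)
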